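/- Every simple graph on 5 vertices with exactly 8 edges (i.e. every graph obtained from the complete graph K_5 by deleting exactly two edges) is gap-vertex-labelable; combined with the fact that deleting one edge from K_5 never yields a gap-vertex-labelable graph, this shows that the gap-strength of K_5 equals 2. -/

import Mathlib

/-- The neighbourhood of `v` in `G` as a `Finset` (classically decidable). -/
noncomputable def gapNbhd {V : Type*} [Fintype V] (G : SimpleGraph V) (v : V) : Finset V :=
  @Finset.filter V (fun u => G.Adj v u) (Classical.decPred _) Finset.univ

/-- The colouring induced by a vertex-labelling `π` : a vertex with at least two neighbours
gets the gap `max − min` of the labels of its neighbours, a vertex with exactly one neighbour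
`u` gets `π u`, and an isolated vertex gets `1`. -/
noncomputable def gapColor {V : Type*} [Fintype V] (G : SimpleGraph V) (π : V → ℕ) (v : V) : ℕ :=
  if h : ((gapNbhd G v).image π).Nonempty then
    if 2 ≤ (gapNbhd G v).card then
      ((gapNbhd G v).image π).max' h - ((gapNbhd G v).image π).min' h
    else ((gapNbhd G v).image π).max' h
  else 1

/-- `π` is a gap-`[k]`-vertex-labelling of `G`: the labels lie in `{1, …, k}` and the induced
colouring is proper. -/
def IsGapLabelling {V : Type*} [Fintype V] (G : SimpleGraph V) (k : ℕ) (π : V → ℕ) : Prop :=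
  (∀ v, 1 ≤ π v ∧ π v ≤ k) ∧
  ∀ u v, G.Adj u v → gapColor G π u ≠ gapColor G π v

/-- `G` is gap-vertex-labelable if it admits a gap-`[k]`-vertex-labelling for some `k ≥ 1`. -/
def GapVertexLabelable {V : Type*} [Fintype V] (G : SimpleGraph V) : Prop :=
  ∃ k, 1 ≤ k ∧ ∃ π, IsGapLabelling G k π

/-- The vertex-gap number: the least `k ≥ 1` for which `G` admits a
gap-`[k]`-vertex-labelling. -/
noncomputable def vertexGapNumber {V : Type*} [Fintype V] (G : SimpleGraph V) : ℕ :=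
  sInf {k | 1 ≤ k ∧ ∃ π, IsGapLabelling G k π}

/-- The gap-strength of `G`: the least number `l` such that some graph obtained from `G` by
removing `l` edges is gap-vertex-labelable. -/
noncomputable def gapStrength {V : Type*} [Fintype V] (G : SimpleGraph V) : ℕ :=
  sInf {l | ∃ H : SimpleGraph V, H ≤ G ∧ H.edgeSet.ncard + l = G.edgeSet.ncard ∧
    GapVertexLabelable H}

theorem mem_gapNbhd {V : Type*} [Fintype V] {G : SimpleGraph V} {u v : V} :
    u ∈ gapNbhd G v ↔ G.Adj v u := by
  simp [gapNbhd]

/-- If `p ≠ q` are neighbours of `v` carrying the largest and the smallest label among the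
neighbours of `v`, then the colour of `v` is `π p - π q`. -/
theorem gapColor_eq_sub {V : Type*} [Fintype V] {G : SimpleGraph V} {π : V → ℕ} {v p q : V}
    (hpq : p ≠ q) (hp : G.Adj v p) (hq : G.Adj v q)
    (h : ∀ u, G.Adj v u → π q ≤ π u ∧ π u ≤ π p) : gapColor G π v = π p - π q := by
  classical
  have hp' : π p ∈ (gapNbhd G v).image π := Finset.mem_image_of_mem π (mem_gapNbhd.2 hp)
  have hq' : π q ∈ (gapNbhd G v).image π := Finset.mem_image_of_mem π (mem_gapNbhd.2 hq)
  have hcard : 2 ≤ (gapNbhd G v).card :=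
    Finset.one_lt_card.2 ⟨p, mem_gapNbhd.2 hp, q, mem_gapNbhd.2 hq, hpq⟩
  unfold gapColor
  rw [dif_pos ⟨_, hp'⟩, if_pos hcard]
  congr 1
  · refine le_antisymm (Finset.max'_le _ _ _ fun y hy => ?_) (Finset.le_max' _ _ hp')
    obtain ⟨u, hu, rfl⟩ := Finset.mem_image.1 hy
    exact (h u (mem_gapNbhd.1 hu)).2
  · refine le_antisymm (Finset.min'_le _ _ hq') (Finset.le_min' _ _ _ fun y hy => ?_)
    obtain ⟨u, hu, rfl⟩ := Finset.mem_image.1 hy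
    exact (h u (mem_gapNbhd.1 hu)).1

/-- A graph is gap-vertex-labelable as soon as an isomorphic relation `R` has a labelling `π`
with selected neighbours `p v`, `q v` of largest and smallest label whose gaps form a proper
colouring. -/
theorem GapVertexLabelable.of_equiv {V W : Type*} [Fintype V] {G : SimpleGraph V}
    {R : W → W → Prop} (f : W ≃ V) (hR : ∀ u v, G.Adj (f u) (f v) ↔ R u v)
    (π : W → ℕ) (p q : W → W) (hπ : ∀ v, 1 ≤ π v) (hpq : ∀ v, p v ≠ q v)
    (hp : ∀ v, R v (p v)) (hq : ∀ v, R v (q v))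
    (h : ∀ v u, R v u → π (q v) ≤ π u ∧ π u ≤ π (p v))
    (hc : ∀ u v, R u v → π (p u) - π (q u) ≠ π (p v) - π (q v)) :
    GapVertexLabelable G := by
  have hcol (v : W) : gapColor G (π ∘ f.symm) (f v) = π (p v) - π (q v) := by
    rw [gapColor_eq_sub (f.injective.ne (hpq v)) ((hR _ _).2 (hp v)) ((hR _ _).2 (hq v))]
    · simp
    · intro u hu
      obtain ⟨u, rfl⟩ := f.surjective u
      simpa using h v u ((hR _ _).1 hu)
  refine ⟨1 + ∑ v, π (f.symm v), by omega, π ∘ f.symm, fun v => ⟨hπ _, ?_⟩, fun u v huv => ?_⟩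
  · have := Finset.single_le_sum (f := fun v => π (f.symm v)) (fun _ _ => Nat.zero_le _)
      (Finset.mem_univ v)
    simp only [Function.comp_apply]
    omega
  · obtain ⟨u, rfl⟩ := f.surjective u
    obtain ⟨v, rfl⟩ := f.surjective v
    rw [hcol, hcol]
    exact hc u v ((hR _ _).1 huv)

/-- If any two distinct vertices have two common neighbours that are adjacent to each other, then
the graph is not gap-vertex-labelable. -/
theorem not_gapVertexLabelable_of_common_neighbours {V : Type*} [Fintype V] [Nontrivial V]
    {G : SimpleGraph V} (h : ∀ p q, p ≠ q → ∃ r v, G.Adj r v ∧ G.Adj r p ∧ G.Adj r q ∧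
      G.Adj v p ∧ G.Adj v q) : ¬ GapVertexLabelable G := by
  rintro ⟨k, -, π, -, hπ⟩
  obtain ⟨p, hp⟩ := Finite.exists_max π
  obtain ⟨q, hpq, hq⟩ : ∃ q, p ≠ q ∧ ∀ u, π q ≤ π u := by
    obtain ⟨q, hq⟩ := Finite.exists_min π
    by_cases hpq : p = q
    · subst hpq
      obtain ⟨q, hne⟩ := exists_ne p
      exact ⟨q, hne.symm, fun u => (hp q).trans (hq u)⟩
    · exact ⟨q, hpq, hq⟩
  obtain ⟨r, v, hrv, hrp, hrq, hvp, hvq⟩ := h p q hpq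
  apply hπ r v hrv
  rw [gapColor_eq_sub hpq hrp hrq fun u _ => ⟨hq u, hp u⟩,
    gapColor_eq_sub hpq hvp hvq fun u _ => ⟨hq u, hp u⟩]

/-- `K_5` minus two disjoint edges. -/
theorem gapVertexLabelable_of_two_disjoint_nonedges {G : SimpleGraph (Fin 5)}
    (f : Fin 5 ≃ Fin 5) (hG : ∀ u v, G.Adj u v ↔ u ≠ v ∧ s(u, v) ≠ s(f 0, f 1) ∧
      s(u, v) ≠ s(f 2, f 3)) : GapVertexLabelable G := by
  refine GapVertexLabelable.of_equiv
    (R := fun u v : Fin 5 => u ≠ v ∧ s(u, v) ≠ s(0, 1) ∧ s(u, v) ≠ s(2, 3)) f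
    (fun u v => by simp only [hG, ne_eq, Sym2.eq_iff, f.injective.eq_iff])
    ![1, 1, 2, 2, 4] ![4, 4, 4, 4, 2] ![2, 2, 0, 0, 0] ?_ ?_ ?_ ?_ ?_ ?_ <;> decide

/-- `K_5` minus two edges with a common end. -/
theorem gapVertexLabelable_of_two_adjacent_nonedges {G : SimpleGraph (Fin 5)}
    (f : Fin 5 ≃ Fin 5) (hG : ∀ u v, G.Adj u v ↔ u ≠ v ∧ s(u, v) ≠ s(f 0, f 1) ∧
      s(u, v) ≠ s(f 1, f 2)) : GapVertexLabelable G := by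
  refine GapVertexLabelable.of_equiv
    (R := fun u v : Fin 5 => u ≠ v ∧ s(u, v) ≠ s(0, 1) ∧ s(u, v) ≠ s(1, 2)) f
    (fun u v => by simp only [hG, ne_eq, Sym2.eq_iff, f.injective.eq_iff])
    ![2, 5, 3, 1, 2] ![2, 4, 0, 1, 1] ![3, 3, 3, 0, 3] ?_ ?_ ?_ ?_ ?_ ?_ <;> decide

/-- Any four distinct elements of `Fin 5` are the images of `0`, `1`, `2`, `3` under a
permutation. -/
theorem exists_perm_fin_five {a b c d : Fin 5} (hab : a ≠ b) (hac : a ≠ c) (had : a ≠ d)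
    (hbc : b ≠ c) (hbd : b ≠ d) (hcd : c ≠ d) :
    ∃ f : Fin 5 ≃ Fin 5, f 0 = a ∧ f 1 = b ∧ f 2 = c ∧ f 3 = d := by
  obtain ⟨e, he⟩ := Finset.exists_mem_notMem_of_card_lt_card
    (s := {a, b, c, d}) (t := (Finset.univ : Finset (Fin 5)))
    (Finset.card_le_four.trans_lt (by simp))
  simp only [Finset.mem_univ, Finset.mem_insert, Finset.mem_singleton, not_or, true_and] at he
  have hf : Function.Injective ![a, b, c, d, e] := by
    intro i j hij
    fin_cases i <;> fin_cases j <;> simp_all [eq_comm]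
  exact ⟨Equiv.ofBijective _ (Finite.injective_iff_bijective.1 hf), rfl, rfl, rfl, rfl⟩

theorem gapVertexLabelable_of_two_nonedges {G : SimpleGraph (Fin 5)} {x y : Sym2 (Fin 5)}
    (hxy : x ≠ y) (hG : Gᶜ.edgeSet = {x, y}) : GapVertexLabelable G := by
  have hadj (u v : Fin 5) : G.Adj u v ↔ u ≠ v ∧ s(u, v) ≠ x ∧ s(u, v) ≠ y := by
    have h := Set.ext_iff.1 hG s(u, v)
    simp only [SimpleGraph.mem_edgeSet, SimpleGraph.compl_adj, Set.mem_insert_iff,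
      Set.mem_singleton_iff] at h
    have hne : G.Adj u v → u ≠ v := G.ne_of_adj
    tauto
  have hx : ¬ x.IsDiag := Gᶜ.not_isDiag_of_mem_edgeSet (hG ▸ Set.mem_insert x {y})
  have hy : ¬ y.IsDiag := Gᶜ.not_isDiag_of_mem_edgeSet (hG ▸ Set.mem_insert_of_mem x rfl)
  clear hG
  by_cases hcommon : ∃ b, b ∈ x ∧ b ∈ y
  · obtain ⟨b, ⟨a, rfl⟩, ⟨c, rfl⟩⟩ := hcommon
    rw [Sym2.mk_isDiag_iff] at hx hy
    have hac : a ≠ c := fun h => hxy (by rw [h])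
    obtain ⟨d, hd⟩ := Finset.exists_mem_notMem_of_card_lt_card
      (s := {a, b, c}) (t := (Finset.univ : Finset (Fin 5)))
      (Finset.card_le_three.trans_lt (by simp))
    simp only [Finset.mem_univ, Finset.mem_insert, Finset.mem_singleton, not_or, true_and] at hd
    obtain ⟨f, rfl, rfl, rfl, rfl⟩ := exists_perm_fin_five (Ne.symm hx) hac (Ne.symm hd.1) hy
      (Ne.symm hd.2.1) (Ne.symm hd.2.2)
    refine gapVertexLabelable_of_two_adjacent_nonedges f fun u v => ?_
    rw [hadj, Sym2.eq_swap (a := f 1) (b := f 0)]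
  · induction x using Sym2.ind with | _ a b
    induction y using Sym2.ind with | _ c d
    rw [Sym2.mk_isDiag_iff] at hx hy
    simp only [Sym2.mem_iff, not_exists, not_and, not_or] at hcommon
    have ha := hcommon a (.inl rfl)
    have hb := hcommon b (.inr rfl)
    obtain ⟨f, rfl, rfl, rfl, rfl⟩ := exists_perm_fin_five hx ha.1 ha.2 hb.1 hb.2 hy
    exact gapVertexLabelable_of_two_disjoint_nonedges f hadj

theorem not_gapVertexLabelable_of_one_nonedge {G : SimpleGraph (Fin 5)} {x : Sym2 (Fin 5)}
    (hG : Gᶜ.edgeSet ⊆ {x}) : ¬ GapVertexLabelable G := by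
  have hadj (u v : Fin 5) (huv : u ≠ v ∧ s(u, v) ≠ x) : G.Adj u v := by
    by_contra h
    exact huv.2 (hG (show Gᶜ.Adj u v from ⟨huv.1, h⟩))
  refine not_gapVertexLabelable_of_common_neighbours fun p q hpq => ?_
  have key : ∀ a b p q : Fin 5, p ≠ q → ∃ r v : Fin 5, (r ≠ v ∧ s(r, v) ≠ s(a, b)) ∧
      (r ≠ p ∧ s(r, p) ≠ s(a, b)) ∧ (r ≠ q ∧ s(r, q) ≠ s(a, b)) ∧
      (v ≠ p ∧ s(v, p) ≠ s(a, b)) ∧ (v ≠ q ∧ s(v, q) ≠ s(a, b)) := by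
    decide
  induction x using Sym2.ind with | _ a b
  obtain ⟨r, v, h₁, h₂, h₃, h₄, h₅⟩ := key a b p q hpq
  exact ⟨r, v, hadj _ _ h₁, hadj _ _ h₂, hadj _ _ h₃, hadj _ _ h₄, hadj _ _ h₅⟩

theorem ncard_edgeSet_top_fin_five : (⊤ : SimpleGraph (Fin 5)).edgeSet.ncard = 10 := by
  rw [Set.ncard_eq_toFinset_card']
  decide

theorem ncard_edgeSet_add_ncard_edgeSet_compl (G : SimpleGraph (Fin 5)) :
    G.edgeSet.ncard + Gᶜ.edgeSet.ncard = 10 := by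
  rw [← Set.ncard_union_eq (SimpleGraph.disjoint_edgeSet.2 disjoint_compl_right),
    ← SimpleGraph.edgeSet_sup, sup_compl_eq_top, ncard_edgeSet_top_fin_five]

theorem gapVertexLabelable_of_ncard_edgeSet_eq_eight {G : SimpleGraph (Fin 5)}
    (hG : G.edgeSet.ncard = 8) : GapVertexLabelable G := by
  have h := ncard_edgeSet_add_ncard_edgeSet_compl G
  obtain ⟨x, y, hxy, hc⟩ := Set.ncard_eq_two.1 (show Gᶜ.edgeSet.ncard = 2 by omega)
  exact gapVertexLabelable_of_two_nonedges hxy hc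

theorem not_gapVertexLabelable_of_nine_le_ncard_edgeSet {G : SimpleGraph (Fin 5)}
    (hG : 9 ≤ G.edgeSet.ncard) : ¬ GapVertexLabelable G := by
  have h := ncard_edgeSet_add_ncard_edgeSet_compl G
  obtain ⟨x, hx⟩ := (Set.ncard_le_one_iff_subset_singleton (Set.toFinite _)).1
    (show Gᶜ.edgeSet.ncard ≤ 1 by omega)
  exact not_gapVertexLabelable_of_one_nonedge hx

theorem exists_ncard_edgeSet_eq_eight : ∃ G : SimpleGraph (Fin 5), G.edgeSet.ncard = 8 := by
  refine ⟨SimpleGraph.fromEdgeSet {s(0, 1), s(2, 3)}ᶜ, ?_⟩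
  rw [SimpleGraph.edgeSet_fromEdgeSet, Set.ncard_eq_toFinset_card']
  decide

/-- Every simple graph on `5` vertices with exactly `8` edges (i.e. every graph obtained from
`K_5` by deleting exactly two edges) is gap-vertex-labelable; hence the gap-strength of `K_5`
equals `2`. -/
theorem gapStrength_K5 :
    (∀ G : SimpleGraph (Fin 5), G.edgeSet.ncard = 8 → GapVertexLabelable G) ∧
      gapStrength (⊤ : SimpleGraph (Fin 5)) = 2 := by
  refine ⟨fun G => gapVertexLabelable_of_ncard_edgeSet_eq_eight, ?_⟩
  obtain ⟨G, hG⟩ := exists_ncard_edgeSet_eq_eight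
  have hmem : 2 ∈ {l | ∃ H : SimpleGraph (Fin 5), H ≤ ⊤ ∧
      H.edgeSet.ncard + l = (⊤ : SimpleGraph (Fin 5)).edgeSet.ncard ∧ GapVertexLabelable H} :=
    ⟨G, le_top, by rw [hG, ncard_edgeSet_top_fin_five],
      gapVertexLabelable_of_ncard_edgeSet_eq_eight hG⟩
  refine le_antisymm (Nat.sInf_le hmem) (le_csInf ⟨2, hmem⟩ ?_)
  rintro l ⟨H, -, hl, hH⟩
  rw [ncard_edgeSet_top_fin_five] at hl
  by_contra hlt
  exact not_gapVertexLabelable_of_nine_le_ncard_edgeSet (by omega) hH
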